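/- arXiv:2004.03395 — 7 statements merged into one kernel-verified Lean document; each statement's English description precedes it below -/
import Mathlib

section
/- If f, g ∈ E satisfy f(x) + g(x) ≤ 1 for all x ∈ X, then the pointwise sum f + g belongs to E and f + g is the least upper bound of f and g in the partially ordered set (E, ≤): f ≤ f+g, g ≤ f+g, and every h ∈ E with f ≤ h and g ≤ h satisfies f + g ≤ h. -/
/-- If `f, g ∈ E` satisfy `f x + g x ≤ 1` for all `x`, then the pointwise
sum `f + g` belongs to `E` and is the least upper bound of `f` and `g` in `(E, ≤)`. -/
theorem stmt_0 {X : Type*} [Nonempty X] (E : Set (X → ℝ))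
    (hrange : ∀ f ∈ E, ∀ x, 0 ≤ f x ∧ f x ≤ 1)
    (hM1 : (0 : X → ℝ) ∈ E)
    (hM2 : ∀ f ∈ E, (1 : X → ℝ) - f ∈ E)
    (hM3 : ∀ F : ℕ → (X → ℝ), (∀ n, F n ∈ E) →
      (∀ i j, i ≠ j → ∀ x, F i x + F j x ≤ 1) →
      ∃ g ∈ E, ∀ x, HasSum (fun n => F n x) (g x))
    (f g : X → ℝ) (hf : f ∈ E) (hg : g ∈ E)
    (hfg : ∀ x, f x + g x ≤ 1) :
    f + g ∈ E ∧ f ≤ f + g ∧ g ≤ f + g ∧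
      ∀ h ∈ E, f ≤ h → g ≤ h → f + g ≤ h := by
  have key : ∀ a ∈ E, ∀ b ∈ E, ∀ c ∈ E, (∀ x, a x + b x ≤ 1) → (∀ x, a x + c x ≤ 1) →
      (∀ x, b x + c x ≤ 1) → a + b + c ∈ E := by
    intro a ha b hb c hc hab hac hbc
    let F : ℕ → (X → ℝ) := fun n => match n with
      | 0 => a
      | 1 => b
      | 2 => c
      | _ + 3 => 0
    obtain ⟨s, hs, hsum⟩ := hM3 F
      (by
        intro n
        match n with
        | 0 => exact ha
        | 1 => exact hb
        | 2 => exact hc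
        | _ + 3 => exact hM1)
      (by
        intro i j hij x
        have h1 := hab x
        have h2 := hac x
        have h3 := hbc x
        have h4 := hrange a ha x
        have h5 := hrange b hb x
        have h6 := hrange c hc x
        match i, j with
        | 0, 0 => exact absurd rfl hij
        | 1, 1 => exact absurd rfl hij
        | 2, 2 => exact absurd rfl hij
        | 0, 1 => simp only [F]; linarith
        | 0, 2 => simp only [F]; linarith
        | 1, 0 => simp only [F]; linarith
        | 1, 2 => simp only [F]; linarith
        | 2, 0 => simp only [F]; linarith
        | 2, 1 => simp only [F]; linarith
        | 0, _ + 3 => simp only [F, Pi.zero_apply]; linarith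
        | 1, _ + 3 => simp only [F, Pi.zero_apply]; linarith
        | 2, _ + 3 => simp only [F, Pi.zero_apply]; linarith
        | _ + 3, 0 => simp only [F, Pi.zero_apply]; linarith
        | _ + 3, 1 => simp only [F, Pi.zero_apply]; linarith
        | _ + 3, 2 => simp only [F, Pi.zero_apply]; linarith
        | _ + 3, _ + 3 => simp only [F, Pi.zero_apply]; linarith)
    have : a + b + c = s := by
      funext x
      have h := hasSum_sum_of_ne_finset_zero (f := fun n => F n x) (s := Finset.range 3)
        (L := SummationFilter.unconditional ℕ)
        (by
          intro n hn
          match n with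
          | 0 => simp at hn
          | 1 => simp at hn
          | 2 => simp at hn
          | _ + 3 => rfl)
      have h' := h.unique (hsum x)
      rw [← h']
      simp [Finset.sum_range_succ, F]
    rw [this]
    exact hs
  refine ⟨?_, ?_, ?_, ?_⟩
  · have := key f hf g hg 0 hM1 hfg (fun x => by simpa using (hrange f hf x).2)
      (fun x => by simpa using (hrange g hg x).2)
    simpa using this
  · intro x
    have := (hrange g hg x).1
    simp only [Pi.add_apply]; linarith
  · intro x
    have := (hrange f hf x).1
    simp only [Pi.add_apply]; linarith
  · intro h hh hfh hgh x
    have := key f hf g hg (1 - h) (hM2 h hh) hfg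
      (fun x => by have := hfh x; simp only [Pi.sub_apply, Pi.one_apply]; linarith)
      (fun x => by have := hgh x; simp only [Pi.sub_apply, Pi.one_apply]; linarith)
    have := (hrange _ this x).2
    simp only [Pi.add_apply, Pi.sub_apply, Pi.one_apply] at this ⊢
    linarith
end

section
/- For every f ∈ E, the constant function 1 belongs to E and is the least upper bound of f and 1 − f in (E, ≤), and the zero function 0 is the greatest lower bound of f and 1 − f in (E, ≤); in particular, every h ∈ E with h ≤ f and h ≤ 1 − f equals 0. -/
/-- For every `f ∈ E`, the constant function `1` belongs to `E` and is the
least upper bound of `f` and `1 - f` in `(E, ≤)`, and the zero function is the greatest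
lower bound of `f` and `1 - f`; in particular every `h ∈ E` with `h ≤ f` and `h ≤ 1 - f`
equals `0`. -/
theorem stmt_1 {X : Type*} [Nonempty X] (E : Set (X → ℝ))
    (hrange : ∀ f ∈ E, ∀ x, 0 ≤ f x ∧ f x ≤ 1)
    (hM1 : (0 : X → ℝ) ∈ E)
    (hM2 : ∀ f ∈ E, (1 : X → ℝ) - f ∈ E)
    (hM3 : ∀ F : ℕ → (X → ℝ), (∀ n, F n ∈ E) →
      (∀ i j, i ≠ j → ∀ x, F i x + F j x ≤ 1) →
      ∃ g ∈ E, ∀ x, HasSum (fun n => F n x) (g x))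
    (f : X → ℝ) (hf : f ∈ E) :
    (1 : X → ℝ) ∈ E ∧
      (f ≤ 1 ∧ (1 : X → ℝ) - f ≤ 1 ∧
        ∀ h ∈ E, f ≤ h → (1 : X → ℝ) - f ≤ h → (1 : X → ℝ) ≤ h) ∧
      ((0 : X → ℝ) ≤ f ∧ (0 : X → ℝ) ≤ (1 : X → ℝ) - f ∧
        ∀ h ∈ E, h ≤ f → h ≤ (1 : X → ℝ) - f → h = 0) := by
  have key : ∀ h ∈ E, h ≤ f → h ≤ (1 : X → ℝ) - f → h = 0 := by
    intro h hh h1 h2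
    obtain ⟨g, -, hg⟩ := hM3 (fun _ => h) (fun _ => hh) (by
      intro i j _ x
      have a := h1 x
      have b := h2 x
      simp only [Pi.sub_apply, Pi.one_apply] at b
      show h x + h x ≤ 1
      linarith)
    funext x
    have hs : Summable (fun _ : ℕ => h x) := (hg x).summable
    exact tendsto_nhds_unique tendsto_const_nhds hs.tendsto_atTop_zero
  refine ⟨by simpa using hM2 0 hM1, ⟨fun x => (hrange f hf x).2, fun x => ?_, ?_⟩,
    fun x => (hrange f hf x).1, fun x => ?_, key⟩
  · have := (hrange f hf x).1
    simp only [Pi.sub_apply, Pi.one_apply]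
    linarith
  · intro h hh h1 h2 x
    have k := key (1 - h) (hM2 h hh) (fun y => by
        have := h2 y
        simp only [Pi.sub_apply, Pi.one_apply] at this ⊢
        linarith) (fun y => by
        have := h1 y
        simp only [Pi.sub_apply, Pi.one_apply]
        linarith)
    have k2 := congrFun k x
    simp only [Pi.sub_apply, Pi.one_apply, Pi.zero_apply] at k2 ⊢
    linarith
  · have := (hrange f hf x).2
    simp only [Pi.sub_apply, Pi.one_apply, Pi.zero_apply]
    linarith
end

section
/- (Orthomodular law.) If f, g ∈ E with f ≤ g pointwise, then the pointwise difference g − f belongs to E, g − f ≤ 1 − f, and g is the least upper bound of f and g − f in the partially ordered set (E, ≤). -/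
/-- Orthomodular law: If `f, g ∈ E` with `f ≤ g` pointwise, then the
pointwise difference `g - f` belongs to `E`, `g - f ≤ 1 - f`, and `g` is the least
upper bound of `f` and `g - f` in `(E, ≤)`. -/
theorem stmt_2 {X : Type*} [Nonempty X] (E : Set (X → ℝ))
    (hrange : ∀ f ∈ E, ∀ x, 0 ≤ f x ∧ f x ≤ 1)
    (hM1 : (0 : X → ℝ) ∈ E)
    (hM2 : ∀ f ∈ E, (1 : X → ℝ) - f ∈ E)
    (hM3 : ∀ F : ℕ → (X → ℝ), (∀ n, F n ∈ E) →
      (∀ i j, i ≠ j → ∀ x, F i x + F j x ≤ 1) →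
      ∃ g ∈ E, ∀ x, HasSum (fun n => F n x) (g x))
    (f g : X → ℝ) (hf : f ∈ E) (hg : g ∈ E) (hfg : f ≤ g) :
    g - f ∈ E ∧ g - f ≤ (1 : X → ℝ) - f ∧
      (f ≤ g ∧ g - f ≤ g ∧ ∀ h ∈ E, f ≤ h → g - f ≤ h → g ≤ h) := by
  have key : ∀ a ∈ E, ∀ b ∈ E, ∀ c ∈ E, (∀ x, a x + b x ≤ 1) → (∀ x, a x + c x ≤ 1) →
      (∀ x, b x + c x ≤ 1) → a + b + c ∈ E := by
    intro a ha b hb c hc hab hac hbc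
    let F : ℕ → (X → ℝ) := fun n => match n with
      | 0 => a
      | 1 => b
      | 2 => c
      | _ + 3 => 0
    obtain ⟨k, hk, hs⟩ := hM3 F
      (by rintro (_ | _ | _ | n) <;> assumption)
      (by
        rintro (_ | _ | _ | i) (_ | _ | _ | j) hij x <;>
          have h1 := hab x <;> have h2 := hac x <;> have h3 := hbc x <;>
          have h4 := hrange a ha x <;> have h5 := hrange b hb x <;>
          have h6 := hrange c hc x <;> simp [F] at hij ⊢ <;> linarith)
    have : a + b + c = k := by
      funext x
      have h := hasSum_sum_of_ne_finset_zero (L := SummationFilter.unconditional ℕ) (f := fun n => F n x) (s := Finset.range 3) (by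
        rintro (_ | _ | _ | n) hn
        · simp at hn
        · simp at hn
        · simp at hn
        · simp [F])
      have h' := h.unique (hs x)
      simpa [Finset.sum_range_succ, F] using h'
    rwa [this]
  have hd : g - f ∈ E := by
    have h := hM2 _ (key f hf (1 - g) (hM2 g hg) 0 hM1
      (fun x => by have := hfg x; simp; linarith)
      (fun x => by have := hrange f hf x; simp; linarith)
      (fun x => by have := hrange g hg x; simp; linarith))
    have e : (1 : X → ℝ) - (f + (1 - g) + 0) = g - f := by
      funext x; simp; ring
    rwa [e] at h
  refine ⟨hd, fun x => ?_, hfg, fun x => ?_, fun h hh h1 h2 x => ?_⟩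
  · have := hrange g hg x
    simp; linarith
  · have := hrange f hf x
    simp; linarith
  · have := hrange _ (key f hf (g - f) hd (1 - h) (hM2 h hh)
      (fun x => by have := hrange g hg x; simp; linarith)
      (fun x => by have := h1 x; simp; linarith)
      (fun x => by have := h2 x; simp at this ⊢; linarith)) x
    simp at this
    linarith
end

section
/- (σ-orthocompleteness.) For every sequence (f_n)_{n∈ℕ} in E with f_i(x) + f_j(x) ≤ 1 for all x whenever i ≠ j, any g ∈ E such that Σ_n f_n(x) converges to g(x) for every x ∈ X is the least upper bound of the set {f_n : n ∈ ℕ} in the partially ordered set (E, ≤): f_n ≤ g for every n, and every h ∈ E with f_n ≤ h for all n satisfies g ≤ h. -/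
/-- σ-orthocompleteness: For every sequence `(F n)` in `E` with
`F i x + F j x ≤ 1` for all `x` whenever `i ≠ j`, any `g ∈ E` such that
`Σ_n F n x` converges to `g x` for every `x` is the least upper bound of
`{F n : n ∈ ℕ}` in `(E, ≤)`. -/
theorem stmt_3 {X : Type*} [Nonempty X] (E : Set (X → ℝ))
    (hrange : ∀ f ∈ E, ∀ x, 0 ≤ f x ∧ f x ≤ 1)
    (hM1 : (0 : X → ℝ) ∈ E)
    (hM2 : ∀ f ∈ E, (1 : X → ℝ) - f ∈ E)
    (hM3 : ∀ F : ℕ → (X → ℝ), (∀ n, F n ∈ E) →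
      (∀ i j, i ≠ j → ∀ x, F i x + F j x ≤ 1) →
      ∃ g ∈ E, ∀ x, HasSum (fun n => F n x) (g x))
    (F : ℕ → (X → ℝ)) (hF : ∀ n, F n ∈ E)
    (horth : ∀ i j, i ≠ j → ∀ x, F i x + F j x ≤ 1)
    (g : X → ℝ) (hg : g ∈ E) (hsum : ∀ x, HasSum (fun n => F n x) (g x)) :
    (∀ n, F n ≤ g) ∧ ∀ h ∈ E, (∀ n, F n ≤ h) → g ≤ h := by
  refine ⟨fun n x => le_hasSum (hsum x) n (fun j _ => (hrange _ (hF j) x).1), ?_⟩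
  intro h hh hle x
  let G : ℕ → (X → ℝ) := fun n => Nat.casesOn n (1 - h) F
  obtain ⟨k, hk, hks⟩ := hM3 G
    (by
      intro n
      cases n with
      | zero => exact hM2 h hh
      | succ n => exact hF n)
    (by
      intro i j hij y
      cases i with
      | zero =>
        cases j with
        | zero => exact absurd rfl hij
        | succ j =>
          have := hle j y
          change (1 - h y) + F j y ≤ 1
          linarith
      | succ i =>
        cases j with
        | zero =>
          have := hle i y
          change F i y + (1 - h y) ≤ 1
          linarith
        | succ j => exact horth i j (fun e => hij (by rw [e])) y)
  have h1 : HasSum (fun n => G n x) (G 0 x + g x) :=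
    HasSum.zero_add (f := fun n => G n x) (hsum x)
  have h2 := (hks x).unique h1
  have h3 := (hrange k hk x).2
  have h4 : G 0 x = 1 - h x := rfl
  linarith
end

section
/- For all linear operators T₁, T₂ on H and every unit vector ψ ∈ H, writing p = p_ψ: tr(T₁ p) · tr(T₂ p) − (1/2) · tr(([T₁, p][T₂, p] + [T₂, p][T₁, p]) p) = (1/2) · tr((T₁T₂ + T₂T₁) p). -/
open scoped ComplexInnerProductSpace

/-- The rank-one projection `p_ψ : x ↦ ⟪ψ, x⟫ • ψ` onto the complex line spanned by a
(unit) vector `ψ`. -/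
noncomputable def pProj {H : Type*} [NormedAddCommGroup H] [InnerProductSpace ℂ H]
    (ψ : H) : H →ₗ[ℂ] H where
  toFun x := ⟪ψ, x⟫ • ψ
  map_add' x y := by simp [inner_add_right, add_smul]
  map_smul' c x := by simp [inner_smul_right, smul_smul]

/-- The commutator `[A, B] = AB - BA` of two endomorphisms. -/
def commE {H : Type*} [NormedAddCommGroup H] [InnerProductSpace ℂ H]
    (A B : H →ₗ[ℂ] H) : H →ₗ[ℂ] H := A * B - B * A

theorem trace_mul_pProj_aux {H : Type*} [NormedAddCommGroup H] [InnerProductSpace ℂ H]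
    [FiniteDimensional ℂ H] (A : H →ₗ[ℂ] H) (ψ : H) :
    LinearMap.trace ℂ H (A * pProj ψ) = ⟪ψ, A ψ⟫ := by
  have h : A * pProj ψ = LinearMap.smulRight (innerSL ℂ ψ).toLinearMap (A ψ) := by
    ext x
    simp [pProj]
  rw [h, LinearMap.trace_smulRight]
  simp

/-- For all linear operators `T₁, T₂` on `H` and every unit vector `ψ`,
writing `p = p_ψ`:
`tr(T₁ p) · tr(T₂ p) − (1/2) tr(([T₁,p][T₂,p] + [T₂,p][T₁,p]) p) = (1/2) tr((T₁T₂ + T₂T₁) p)`. -/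
theorem stmt_6 {H : Type*} [NormedAddCommGroup H] [InnerProductSpace ℂ H]
    [FiniteDimensional ℂ H] (T₁ T₂ : H →ₗ[ℂ] H) (ψ : H) (hψ : ‖ψ‖ = 1) :
    LinearMap.trace ℂ H (T₁ * pProj ψ) * LinearMap.trace ℂ H (T₂ * pProj ψ) -
        (1 / 2 : ℂ) * LinearMap.trace ℂ H
          ((commE T₁ (pProj ψ) * commE T₂ (pProj ψ) +
            commE T₂ (pProj ψ) * commE T₁ (pProj ψ)) * pProj ψ) =
      (1 / 2 : ℂ) * LinearMap.trace ℂ H ((T₁ * T₂ + T₂ * T₁) * pProj ψ) := by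
  have hp : ⟪ψ, ψ⟫ = (1 : ℂ) := by simp [inner_self_eq_norm_sq_to_K, hψ]
  simp only [trace_mul_pProj_aux]
  simp only [commE, pProj, LinearMap.add_apply, LinearMap.sub_apply, Module.End.mul_apply,
    LinearMap.coe_mk, AddHom.coe_mk, map_sub, map_smul, inner_add_right, inner_sub_right,
    inner_smul_right, hp, smul_sub, one_smul, smul_eq_mul]
  ring
end

section
/- (The ⋆-product of trace functions equals the trace of the operator product.) For all linear operators T₁, T₂ on H and every unit vector ψ ∈ H, writing p = p_ψ: tr(T₁ p) · tr(T₂ p) + (1/2) · tr([T₁, T₂] p) − (1/2) · tr(([T₁, p][T₂, p] + [T₂, p][T₁, p]) p) = tr(T₁ T₂ p). -/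
open scoped ComplexInnerProductSpace

/-- the ⋆-product of trace functions equals the trace of the operator
product: For all linear operators `T₁, T₂` on `H` and every unit vector `ψ`, writing
`p = p_ψ`:
`tr(T₁p)·tr(T₂p) + (1/2)tr([T₁,T₂]p) − (1/2)tr(([T₁,p][T₂,p] + [T₂,p][T₁,p])p) = tr(T₁T₂p)`. -/
theorem stmt_7 {H : Type*} [NormedAddCommGroup H] [InnerProductSpace ℂ H]
    [FiniteDimensional ℂ H] (T₁ T₂ : H →ₗ[ℂ] H) (ψ : H) (hψ : ‖ψ‖ = 1) :
    LinearMap.trace ℂ H (T₁ * pProj ψ) * LinearMap.trace ℂ H (T₂ * pProj ψ) +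
        (1 / 2 : ℂ) * LinearMap.trace ℂ H (commE T₁ T₂ * pProj ψ) -
        (1 / 2 : ℂ) * LinearMap.trace ℂ H
          ((commE T₁ (pProj ψ) * commE T₂ (pProj ψ) +
            commE T₂ (pProj ψ) * commE T₁ (pProj ψ)) * pProj ψ) =
      LinearMap.trace ℂ H (T₁ * T₂ * pProj ψ) := by
  have h1 : ⟪ψ, ψ⟫ = (1 : ℂ) := by
    rw [inner_self_eq_norm_sq_to_K, hψ]; simp
  simp only [trace_mul_pProj_aux]
  simp only [commE, pProj, LinearMap.add_apply, LinearMap.sub_apply, Module.End.mul_apply,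
    LinearMap.coe_mk, AddHom.coe_mk, map_sub, map_smul, inner_add_right, inner_sub_right,
    inner_smul_right, h1, one_smul]
  ring
end

section
/- Let P, Q be orthogonal projections on H (self-adjoint idempotent linear operators). The following are equivalent: (a) tr(P Q p_ψ) = 0 for every unit vector ψ ∈ H; (b) P Q = 0; (c) tr(P p_ψ) + tr(Q p_ψ) ≤ 1 for every unit vector ψ ∈ H. In the language of fuzzy events, the ⋆-product of the membership functions μ_P and μ_Q vanishes if and only if μ_P + μ_Q ≤ 1 pointwise. -/
open scoped ComplexInnerProductSpace

theorem re_proj_aux {H : Type*} [NormedAddCommGroup H] [InnerProductSpace ℂ H]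
    (P : H →ₗ[ℂ] H) (hP : P.IsSymmetric) (hP2 : P * P = P) (x : H) :
    (⟪x, P x⟫).re = ‖P x‖ ^ 2 := by
  have h1 : P (P x) = P x := by
    have := congrArg (fun T => T x) hP2
    simpa using this
  rw [← h1, ← hP, inner_self_eq_norm_sq_to_K, h1]
  norm_cast

/-- Let `P, Q` be orthogonal projections on `H` (self-adjoint idempotent
linear operators). The following are equivalent: (a) `tr(PQ p_ψ) = 0` for every unit
vector `ψ`; (b) `PQ = 0`; (c) `tr(P p_ψ) + tr(Q p_ψ) ≤ 1` for every unit vector `ψ`.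
In fuzzy language, the ⋆-product of `μ_P` and `μ_Q` vanishes iff `μ_P + μ_Q ≤ 1`
pointwise. -/
theorem stmt_11 {H : Type*} [NormedAddCommGroup H] [InnerProductSpace ℂ H]
    [FiniteDimensional ℂ H] (P Q : H →ₗ[ℂ] H)
    (hP : P.IsSymmetric) (hP2 : P * P = P)
    (hQ : Q.IsSymmetric) (hQ2 : Q * Q = Q) :
    ((∀ ψ : H, ‖ψ‖ = 1 → LinearMap.trace ℂ H (P * Q * pProj ψ) = 0) ↔ P * Q = 0) ∧
      (P * Q = 0 ↔
        ∀ ψ : H, ‖ψ‖ = 1 →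
          (LinearMap.trace ℂ H (P * pProj ψ)).re +
            (LinearMap.trace ℂ H (Q * pProj ψ)).re ≤ 1) := by
  simp only [trace_mul_pProj_aux, re_proj_aux P hP hP2, re_proj_aux Q hQ hQ2]
  refine ⟨⟨fun h => ?_, fun h ψ _ => by simp [h]⟩, fun h ψ hψ => ?_, fun h => ?_⟩
  · rw [← inner_map_self_eq_zero]
    intro x
    by_cases hx : x = 0
    · simp [hx]
    have hn : ‖x‖ ≠ 0 := by simpa using hx
    have h1 := h (((‖x‖ : ℂ)⁻¹) • x) (by simp [norm_smul, hn])
    rw [map_smul, inner_smul_left, inner_smul_right] at h1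
    have h2 : ⟪x, (P * Q) x⟫ = 0 := by simpa [hx] using h1
    exact inner_eq_zero_symm.mp h2
  · have e : ⟪P ψ, Q ψ⟫ = 0 := by
      rw [hP]
      have := congrArg (fun T => T ψ) h
      simp at this
      simp [this]
    have hp := re_proj_aux P hP hP2 ψ
    have hq := re_proj_aux Q hQ hQ2 ψ
    have h1 := norm_sub_sq (𝕜 := ℂ) ψ (P ψ + Q ψ)
    have h2 := norm_add_sq (𝕜 := ℂ) (P ψ) (Q ψ)
    rw [inner_add_right] at h1
    rw [e] at h2
    simp [hψ, hp, hq] at h1 h2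
    nlinarith [sq_nonneg ‖ψ - (P ψ + Q ψ)‖]
  · ext x
    have hy : Q (Q x) = Q x := by
      have := congrArg (fun T => T x) hQ2
      simpa using this
    by_cases hx : Q x = 0
    · simp [hx]
    have hn : ‖Q x‖ ≠ 0 := by simpa using hx
    have h1 := h (((‖Q x‖ : ℂ)⁻¹) • Q x) (by simp [norm_smul, hn])
    rw [map_smul, map_smul, hy, norm_smul, norm_smul] at h1
    simp [hn] at h1
    simpa [hx] using h1
end
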